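/- Let T be a Morse tile of dimension n with underlying simplex σ, restriction set R and Morse face μ (possibly absent), and let θ be a face of σ of positive dimension. If θ is not contained in μ (in particular if T is basic), then the stellar subdivision of T at θ carries a Morse shelling all of whose tiles are regular basic tiles of dimension n together with exactly one tile isomorphic to T. If θ is contained in μ, then the stellar subdivision of T at θ carries a Morse shelling all of whose tiles are regular Morse tiles of dimension n together with exactly one tile isomorphic to T. -/

import Mathlib

open Finset

variable {V : Type*} [DecidableEq V]

/-- A finite simplicial complex: a finite collection of finite sets of vertices
closed under taking subsets. -/
def IsComplex (K : Finset (Finset V)) : Prop :=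
  ∀ σ ∈ K, ∀ τ ⊆ σ, τ ∈ K

/-- The set of nonempty faces of the relative simplicial complex `K ∖ L`. -/
def relFaces (K L : Finset (Finset V)) : Finset (Finset V) :=
  (K \ L).filter (fun τ => τ ≠ ∅)

/-- A set `A` of faces is closed in `S`: every nonempty face of `S` contained in a
member of `A` belongs to `A`. -/
def closedIn (S A : Finset (Finset V)) : Prop :=
  ∀ τ ∈ S, τ ≠ ∅ → ∀ α ∈ A, τ ⊆ α → τ ∈ A

/-- A facet: a maximal face. -/
def IsFacetOf (K : Finset (Finset V)) (θ : Finset V) : Prop :=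
  θ ∈ K ∧ ∀ σ ∈ K, θ ⊆ σ → σ = θ

instance (K : Finset (Finset V)) (θ : Finset V) : Decidable (IsFacetOf K θ) :=
  inferInstanceAs (Decidable (θ ∈ K ∧ ∀ σ ∈ K, θ ⊆ σ → σ = θ))

/-- A ridge: a face of codimension one in every facet containing it. -/
def IsRidgeOf (K : Finset (Finset V)) (θ : Finset V) : Prop :=
  θ ∈ K ∧ ∀ σ, IsFacetOf K σ → θ ⊆ σ → σ.card = θ.card + 1

/-- Stellar subdivision of `K` at the face `θ`, using the new vertex `v`. -/
def stellar (K : Finset (Finset V)) (θ : Finset V) (v : V) : Finset (Finset V) :=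
  K.filter (fun σ => ¬ θ ⊆ σ) ∪
    (K.filter (fun ρ => ¬ θ ⊆ ρ ∧ ρ ∪ θ ∈ K)).image (fun ρ => insert v ρ)

/-- Barycentric subdivision: faces are the chains of nonempty faces of `K`. -/
def barySd (K : Finset (Finset V)) : Finset (Finset (Finset V)) :=
  K.powerset.filter (fun c => ∅ ∉ c ∧ ∀ τ ∈ c, ∀ τ' ∈ c, τ ⊆ τ' ∨ τ' ⊆ τ)

/-- A Morse tile: a simplex `simplex` deprived of the ridges not containing `res`,
together possibly with a Morse face `morse` of higher codimension. -/
structure MorseTile (V : Type*) where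
  simplex : Finset V
  res : Finset V
  morse : Option (Finset V)
  simplex_nonempty : simplex.Nonempty
  res_sub : res ⊆ simplex
  morse_res : ∀ μ ∈ morse, res ⊆ μ
  morse_ssub : ∀ μ ∈ morse, μ ⊂ simplex
  morse_card : ∀ μ ∈ morse, μ.card + 2 ≤ simplex.card

namespace MorseTile

/-- The face set of a Morse tile. -/
def faceSet (T : MorseTile V) : Finset (Finset V) :=
  match T.morse with
  | none => T.simplex.powerset.filter (fun τ => T.res ⊆ τ ∧ τ ≠ ∅)
  | some μ => T.simplex.powerset.filter (fun τ => T.res ⊆ τ ∧ ¬ τ ⊆ μ)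

/-- The dimension of a Morse tile. -/
def dim (T : MorseTile V) : ℕ := T.simplex.card - 1

/-- The order of a Morse tile. -/
def order (T : MorseTile V) : ℕ := T.res.card

/-- The index of a (critical) Morse tile. -/
def index (T : MorseTile V) : ℕ :=
  if T.res = T.simplex then T.simplex.card - 1 else T.res.card

/-- Basic tiles: no Morse face. -/
def IsBasic (T : MorseTile V) : Prop := T.morse = none

/-- Critical tiles: the Morse face equals the restriction set, or the open simplex. -/
def IsCritical (T : MorseTile V) : Prop := T.morse = some T.res ∨ T.res = T.simplex

/-- Tiles allowed in an h-tiling: basic or critical tiles. -/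
def IsHTile (T : MorseTile V) : Prop := T.morse = none ∨ T.morse = some T.res

/-- The closed simplex. -/
def IsClosedSimplex (T : MorseTile V) : Prop := T.morse = none ∧ T.res = ∅

/-- The open simplex. -/
def IsOpenSimplex (T : MorseTile V) : Prop := T.morse = none ∧ T.res = T.simplex

instance (T : MorseTile V) : Decidable T.IsCritical :=
  inferInstanceAs (Decidable (T.morse = some T.res ∨ T.res = T.simplex))

/-- Isomorphism of Morse tiles: a bijection between the underlying simplices mapping
the face set of one onto the face set of the other. -/
def Isom (T T' : MorseTile V) : Prop :=
  ∃ e : V → V, Set.InjOn e (T.simplex : Set V) ∧ T.simplex.image e = T'.simplex ∧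
    T.faceSet.image (fun τ => τ.image e) = T'.faceSet

/-- The subcomplex `L_T` of removed faces of a Morse tile. -/
def removed (T : MorseTile V) : Finset (Finset V) :=
  T.simplex.powerset.filter (fun τ => τ ∉ T.faceSet)

/-- The stellar subdivision of a Morse tile at a face `θ` of its underlying simplex,
as a relative simplicial complex. -/
def stellarSub (T : MorseTile V) (θ : Finset V) (v : V) : Finset (Finset V) :=
  relFaces (stellar T.simplex.powerset θ v) (stellar T.removed θ v)

end MorseTile

/-- The union of the face sets of a list of Morse tiles. -/
def faceUnion (ts : List (MorseTile V)) : Finset (Finset V) :=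
  ts.foldr (fun T A => T.faceSet ∪ A) ∅

/-- A Morse tiling of the set `S` of nonempty faces of a relative complex:
the face sets of the tiles partition `S`, and for every `d` the union of the
face sets of the tiles of dimension at least `d` is closed in `S`. -/
def IsMorseTiling (S : Finset (Finset V)) (ts : List (MorseTile V)) : Prop :=
  ts.Pairwise (fun T T' => Disjoint T.faceSet T'.faceSet) ∧
  faceUnion ts = S ∧
  ∀ d : ℕ, closedIn S (faceUnion (ts.filter (fun T => decide (d ≤ T.dim))))

/-- A Morse shelling: a Morse tiling whose order makes every initial union closed. -/
def IsMorseShelling (S : Finset (Finset V)) (ts : List (MorseTile V)) : Prop :=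
  IsMorseTiling S ts ∧ ∀ p : ℕ, closedIn S (faceUnion (ts.take p))

/-- An h-tiling: a Morse tiling all of whose tiles are basic or critical. -/
def IsHTiling (S : Finset (Finset V)) (ts : List (MorseTile V)) : Prop :=
  IsMorseTiling S ts ∧ ∀ T ∈ ts, T.IsHTile

/-- A shellable (shelled) h-tiling. -/
def IsHShelling (S : Finset (Finset V)) (ts : List (MorseTile V)) : Prop :=
  IsMorseShelling S ts ∧ ∀ T ∈ ts, T.IsHTile

/-- The number of critical tiles of index `k`. -/
def criticalCount (ts : List (MorseTile V)) (k : ℕ) : ℕ :=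
  ts.countP (fun T => decide (T.IsCritical ∧ T.index = k))

/-- The total number of critical tiles. -/
def totalCritical (ts : List (MorseTile V)) : ℕ :=
  ts.countP (fun T => decide T.IsCritical)

/-- The number of tiles of order `k`. -/
def hCount (ts : List (MorseTile V)) (k : ℕ) : ℕ :=
  ts.countP (fun T => decide (T.order = k))

/-- The number of `k`-dimensional faces. -/
def fCount (S : Finset (Finset V)) (k : ℕ) : ℕ :=
  (S.filter (fun τ => τ.card = k + 1)).card

/-- The Euler characteristic of a set of nonempty faces. -/
def eulerChar (S : Finset (Finset V)) : ℤ :=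
  ∑ τ ∈ S, (-1 : ℤ) ^ (τ.card - 1)

/-- A pure `n`-dimensional complex: it has an `n`-dimensional face and all its
facets have dimension `n`. -/
def IsPureDim (n : ℕ) (K : Finset (Finset V)) : Prop :=
  (∃ σ ∈ K, σ.card = n + 1) ∧ ∀ θ, IsFacetOf K θ → θ.card = n + 1

/-- A closed `n`-dimensional pseudo-manifold: a pure `n`-dimensional complex in
which every `(n-1)`-dimensional face is contained in exactly two facets. -/
def IsPseudoManifold (n : ℕ) (K : Finset (Finset V)) : Prop :=
  IsComplex K ∧ IsPureDim n K ∧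
  ∀ ρ ∈ K, ρ.card = n → (K.filter (fun σ => IsFacetOf K σ ∧ ρ ⊆ σ)).card = 2

/-- Strong connectedness: any two facets are joined by a sequence of facets in which
consecutive ones share an `(n-1)`-dimensional face. -/
def StronglyConnected (n : ℕ) (K : Finset (Finset V)) : Prop :=
  ∀ σ σ', IsFacetOf K σ → IsFacetOf K σ' →
    ∃ (m : ℕ) (c : ℕ → Finset V), c 0 = σ ∧ c m = σ' ∧
      (∀ i ≤ m, IsFacetOf K (c i)) ∧
      ∀ i < m, ∃ ρ : Finset V, ρ.card = n ∧ ρ ⊆ c i ∧ ρ ⊆ c (i + 1)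

/-- Classical shellability of a finite simplicial complex. -/
def ClassicallyShellable (K : Finset (Finset V)) : Prop :=
  ∃ (N : ℕ) (f : Fin N → Finset V), Function.Injective f ∧
    (∀ σ, IsFacetOf K σ ↔ ∃ i, f i = σ) ∧
    ∀ p : Fin N, 0 < (p : ℕ) →
      ∃ R : Finset V, R ≠ ∅ ∧ R ⊆ f p ∧
        ∀ τ : Finset V,
          ((τ ≠ ∅ ∧ τ ⊆ f p ∧ ∀ q, q < p → ¬ τ ⊆ f q) ↔ (R ⊆ τ ∧ τ ⊆ f p))

/-- The faces in `S` missing the vertex `x` and containing `P`. -/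
def cell (S : Finset (Finset V)) (P : Finset V) (x : V) : Finset (Finset V) :=
  S.filter (fun τ => x ∉ τ ∧ P ⊆ τ)

lemma mem_cell {S : Finset (Finset V)} {P : Finset V} {x : V} {τ : Finset V} :
    τ ∈ cell S P x ↔ τ ∈ S ∧ x ∉ τ ∧ P ⊆ τ := by
  simp [cell]

lemma mem_faceUnion {ts : List (MorseTile V)} {τ : Finset V} :
    τ ∈ faceUnion ts ↔ ∃ T ∈ ts, τ ∈ T.faceSet := by
  induction ts with
  | nil => simp [faceUnion]
  | cons T ts ih =>
    have : faceUnion (T :: ts) = T.faceSet ∪ faceUnion ts := rfl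
    simp [this, ih]

/-- Sorting the faces of `S` by the first vertex of a list they miss yields a Morse shelling, as
soon as every resulting cell is the face set of a tile of a fixed dimension. -/
lemma exists_shelling_of_list {S : Finset (Finset V)} {n : ℕ} {xs : List V}
    (hcov : ∀ τ ∈ S, ∃ x ∈ xs, x ∉ τ) {Q : List V → V → MorseTile V → Prop}
    (h : ∀ l₁ x l₂, xs = l₁ ++ x :: l₂ →
      ∃ t : MorseTile V, t.faceSet = cell S l₁.toFinset x ∧ t.dim = n ∧ Q l₁ x t) :
    ∃ ts : List (MorseTile V), IsMorseShelling S ts ∧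
      (∀ t ∈ ts, t.dim = n ∧ ∃ l₁ x l₂, xs = l₁ ++ x :: l₂ ∧ Q l₁ x t) ∧
      ∀ l₁ x l₂, xs = l₁ ++ x :: l₂ → ∃ t ∈ ts, Q l₁ x t := by
  have hsplit (i : Fin xs.length) : xs = xs.take i ++ xs[i] :: xs.drop (i + 1) := by simp
  choose t htf htd htQ using fun i : Fin xs.length => h _ _ _ (hsplit i)
  have hmem (i : Fin xs.length) (τ : Finset V) :
      τ ∈ (t i).faceSet ↔ τ ∈ S ∧ xs[i] ∉ τ ∧ ∀ j : Fin xs.length, j < i → xs[j] ∈ τ := by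
    rw [htf, mem_cell]
    refine and_congr_right fun _ => and_congr_right fun _ => ⟨fun hs j hj => hs ?_, fun hs y hy => ?_⟩
    · rw [List.mem_toFinset, List.mem_take_iff_getElem]
      exact ⟨j, by have := i.2; have : j.1 < i.1 := hj; omega, rfl⟩
    · rw [List.mem_toFinset, List.mem_take_iff_getElem] at hy
      obtain ⟨j, hj, rfl⟩ := hy
      exact hs ⟨j, by omega⟩ (show j < i.1 by omega)
  have hfirst (τ : Finset V) (hτ : τ ∈ S) (i : Fin xs.length) (hi : xs[i] ∉ τ) :
      ∃ j ≤ i, τ ∈ (t j).faceSet := by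
    induction i using WellFoundedLT.induction with
    | ind i ih =>
      by_cases hj : ∀ j : Fin xs.length, j < i → xs[j] ∈ τ
      · exact ⟨i, le_rfl, (hmem i τ).2 ⟨hτ, hi, hj⟩⟩
      · push Not at hj
        obtain ⟨j, hji, hj⟩ := hj
        obtain ⟨k, hk, hkτ⟩ := ih j hji hj
        exact ⟨k, hk.trans hji.le, hkτ⟩
  have hunion : faceUnion (List.ofFn t) = S := by
    ext τ
    rw [mem_faceUnion]
    constructor
    · rintro ⟨T, hT, hτ⟩
      obtain ⟨i, rfl⟩ := List.mem_ofFn.1 hT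
      exact ((hmem i τ).1 hτ).1
    · intro hτ
      obtain ⟨x, hx, hxτ⟩ := hcov τ hτ
      obtain ⟨i, hi, rfl⟩ := List.getElem_of_mem hx
      obtain ⟨j, -, hj⟩ := hfirst τ hτ ⟨i, hi⟩ hxτ
      exact ⟨t j, List.mem_ofFn.2 ⟨j, rfl⟩, hj⟩
  have hdimT : ∀ T ∈ List.ofFn t, T.dim = n := by
    intro T hT
    obtain ⟨i, rfl⟩ := List.mem_ofFn.1 hT
    exact htd i
  refine ⟨List.ofFn t, ⟨⟨?_, hunion, fun d => ?_⟩, fun p => ?_⟩, fun T hT => ⟨hdimT T hT, ?_⟩, ?_⟩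
  · rw [List.pairwise_ofFn]
    intro i j hij
    rw [Finset.disjoint_left]
    intro τ hi hj
    exact ((hmem i τ).1 hi).2.1 (((hmem j τ).1 hj).2.2 i hij)
  · by_cases hd : d ≤ n
    · rw [List.filter_eq_self.2 fun T hT => by simpa [hdimT T hT] using hd, hunion]
      exact fun τ hτ _ _ _ _ => hτ
    · rw [List.filter_eq_nil_iff.2 fun T hT => by simpa [hdimT T hT] using hd]
      simp [closedIn, faceUnion]
  · intro τ hτ _ α hα hτα
    rw [mem_faceUnion] at hα ⊢
    obtain ⟨T, hT, hα⟩ := hα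
    obtain ⟨i, hi, rfl⟩ := List.mem_take_iff_getElem.1 hT
    rw [List.getElem_ofFn] at hα
    obtain ⟨j, hji, hj⟩ := hfirst τ hτ ⟨i, by simp at hi; omega⟩
      fun hx => ((hmem _ α).1 hα).2.1 (hτα hx)
    have hji' : j.1 ≤ i := hji
    exact ⟨t j, List.mem_take_iff_getElem.2 ⟨j, by simp at hi ⊢; omega, by simp⟩, hj⟩
  · obtain ⟨i, rfl⟩ := List.mem_ofFn.1 hT
    exact ⟨_, _, _, hsplit i, htQ i⟩
  · intro l₁ x l₂ hx
    have hlen : l₁.length < xs.length := by simp [hx]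
    refine ⟨t ⟨l₁.length, hlen⟩, List.mem_ofFn.2 ⟨_, rfl⟩, ?_⟩
    have := htQ ⟨l₁.length, hlen⟩
    subst hx
    simpa using this

/-- The shelling obtained by first listing the vertices of `A`, then `x₀`, then those of `B`. -/
lemma exists_shelling_of_pivot {S : Finset (Finset V)} {n : ℕ} {A B : Finset V} {x₀ : V}
    (hA : x₀ ∉ A) (hB : x₀ ∉ B) (hAB : Disjoint A B)
    (hcov : ∀ τ ∈ S, ¬ insert x₀ (A ∪ B) ⊆ τ) {Q : MorseTile V → Prop} {T₀ : MorseTile V}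
    (hT₀ : T₀.faceSet = cell S A x₀) (hT₀dim : T₀.dim = n)
    (h₁ : ∀ x ∈ A, ∀ P ⊆ A, x ∉ P →
      ∃ t : MorseTile V, t.faceSet = cell S P x ∧ t.dim = n ∧ Q t)
    (h₂ : ∀ x ∈ B, ∀ P ⊆ insert x₀ (A ∪ B), insert x₀ A ⊆ P → x ∉ P →
      ∃ t : MorseTile V, t.faceSet = cell S P x ∧ t.dim = n ∧ Q t) :
    ∃ ts : List (MorseTile V), IsMorseShelling S ts ∧ T₀ ∈ ts ∧
      ∀ t ∈ ts, t.dim = n ∧ (t ≠ T₀ → Q t) := by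
  have hnd : (A.toList ++ x₀ :: B.toList).Nodup := by
    rw [List.nodup_append, List.nodup_cons]
    simp only [mem_toList, nodup_toList, List.mem_cons]
    refine ⟨trivial, ⟨hB, trivial⟩, ?_⟩
    rintro a ha b (rfl | hb) rfl
    · exact hA ha
    · exact Finset.disjoint_left.1 hAB ha hb
  obtain ⟨ts, hts, hQ, hmem⟩ := exists_shelling_of_list (S := S) (n := n)
    (xs := A.toList ++ x₀ :: B.toList)
    (Q := fun _ x t => if x = x₀ then t = T₀ else Q t)
    (fun τ hτ => by
      obtain ⟨x, hx, hxτ⟩ := Finset.not_subset.1 (hcov τ hτ)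
      refine ⟨x, ?_, hxτ⟩
      simp only [List.mem_append, List.mem_cons, mem_toList]
      simp only [mem_insert, mem_union] at hx
      tauto)
    (fun l₁ x l₂ hl => by
      have hnd' := hl ▸ hnd
      have hx : x ∉ l₁ := fun hx => by
        rw [List.nodup_append] at hnd'
        exact hnd'.2.2 x hx x (by simp) rfl
      have hsub : ∀ y ∈ l₁, y ∈ insert x₀ (A ∪ B) := fun y hy => by
        have : y ∈ A.toList ++ x₀ :: B.toList := by rw [hl]; simp [hy]
        simp only [List.mem_append, List.mem_cons, mem_toList] at this
        simp only [mem_insert, mem_union]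
        tauto
      rcases List.append_eq_append_iff.1 hl with ⟨as, rfl, has⟩ | ⟨bs, hbs, hbs'⟩
      · cases as with
        | nil =>
          simp only [List.nil_append, List.cons.injEq] at has
          obtain ⟨rfl, -⟩ := has
          exact ⟨T₀, by simpa using hT₀, hT₀dim, by simp⟩
        | cons y as =>
          simp only [List.cons_append, List.cons.injEq] at has
          obtain ⟨rfl, has⟩ := has
          have hxB : x ∈ B := by rw [← mem_toList, has]; simp
          obtain ⟨t, ht, htd, htQ⟩ := h₂ x hxB (A.toList ++ x₀ :: as).toFinset
            (fun y hy => hsub y (List.mem_toFinset.1 hy))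
            (fun y hy => by simp at hy ⊢; tauto) (fun h => hx (List.mem_toFinset.1 h))
          refine ⟨t, ht, htd, ?_⟩
          rw [if_neg (ne_of_mem_of_not_mem hxB hB)]
          exact htQ
      · cases bs with
        | nil =>
          simp only [List.nil_append, List.cons.injEq] at hbs'
          obtain ⟨rfl, -⟩ := hbs'
          simp only [List.append_nil] at hbs
          subst hbs
          exact ⟨T₀, by simpa using hT₀, hT₀dim, by simp⟩
        | cons y bs =>
          simp only [List.cons_append, List.cons.injEq] at hbs'
          obtain ⟨rfl, -⟩ := hbs'
          have hxA : x ∈ A := by rw [← mem_toList, hbs]; simp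
          obtain ⟨t, ht, htd, htQ⟩ := h₁ x hxA l₁.toFinset
            (fun y hy => by rw [← mem_toList, hbs]; simp [List.mem_toFinset.1 hy])
            (by simpa using hx)
          refine ⟨t, ht, htd, ?_⟩
          rw [if_neg (ne_of_mem_of_not_mem hxA hA)]
          exact htQ)
  obtain ⟨t, ht, htQ⟩ := hmem _ _ _ rfl
  rw [if_pos rfl] at htQ
  subst htQ
  refine ⟨ts, hts, ht, fun t' ht' => ⟨(hQ t' ht').1, fun hne => ?_⟩⟩
  obtain ⟨-, l₁, x, l₂, -, hq⟩ := hQ t' ht'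
  split_ifs at hq
  · exact absurd hq hne
  · exact hq

namespace MorseTile

lemma mem_faceSet {T : MorseTile V} {τ : Finset V} :
    τ ∈ T.faceSet ↔ τ ⊆ T.simplex ∧ T.res ⊆ τ ∧ τ ≠ ∅ ∧ ∀ μ ∈ T.morse, ¬ τ ⊆ μ := by
  unfold faceSet
  cases h : T.morse with
  | none => simp
  | some μ =>
    simp only [mem_filter, mem_powerset, Option.mem_def, Option.some.injEq, forall_eq']
    refine and_congr_right fun _ => and_congr_right fun _ => ⟨fun h => ⟨?_, h⟩, fun h => h.2⟩
    rintro rfl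
    exact h (empty_subset _)

lemma mem_removed {T : MorseTile V} {τ : Finset V} :
    τ ∈ T.removed ↔ τ ⊆ T.simplex ∧ τ ∉ T.faceSet := by
  simp [removed]

lemma faceSet_upward {T : MorseTile V} {τ τ' : Finset V} (h : τ ∈ T.faceSet) (hs : τ ⊆ τ')
    (h' : τ' ⊆ T.simplex) : τ' ∈ T.faceSet := by
  rw [mem_faceSet] at h ⊢
  obtain ⟨-, h2, h3, h4⟩ := h
  exact ⟨h', h2.trans hs, fun h => h3 (subset_empty.1 (h ▸ hs)), fun μ hμ h => h4 μ hμ (hs.trans h)⟩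

lemma mem_stellarSub {T : MorseTile V} {θ : Finset V} {v : V} (hθ : θ ⊆ T.simplex)
    (hne : θ.Nonempty) (hv : v ∉ T.simplex) {τ : Finset V} :
    τ ∈ T.stellarSub θ v ↔ τ ⊆ insert v T.simplex ∧ ¬ θ ⊆ τ ∧
      (v ∉ τ → T.res ⊆ τ ∧ τ ≠ ∅ ∧ ∀ μ ∈ T.morse, ¬ τ ⊆ μ) ∧
      (v ∈ τ → T.res ⊆ τ ∪ θ ∧ ∀ μ ∈ T.morse, θ ⊆ μ → ¬ τ ⊆ insert v μ) := by
  by_cases hvτ : v ∈ τ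
  · obtain ⟨ρ, hρ, rfl⟩ : ∃ ρ, v ∉ ρ ∧ τ = insert v ρ := ⟨τ.erase v, by simp, by simp [hvτ]⟩
    have hvθ : v ∉ θ := fun h => hv (hθ h)
    have hθρ : θ ⊆ insert v ρ ↔ θ ⊆ ρ := subset_insert_iff_of_notMem hvθ
    have himg (L : Finset (Finset V)) (hL : ∀ σ ∈ L, σ ⊆ T.simplex) :
        insert v ρ ∈ stellar L θ v ↔ ρ ∈ L ∧ ¬ θ ⊆ ρ ∧ ρ ∪ θ ∈ L := by
      simp only [stellar, mem_union, mem_filter, mem_image]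
      constructor
      · rintro (⟨h, -⟩ | ⟨ρ', ⟨h1, h2, h3⟩, h4⟩)
        · exact absurd (hL _ h (mem_insert_self _ _)) hv
        · have : ρ' = ρ := by
            rw [← erase_insert hρ, ← h4, erase_insert (fun h => hv (hL _ h1 h))]
          exact this ▸ ⟨h1, h2, h3⟩
      · exact fun h => Or.inr ⟨ρ, h, rfl⟩
    have hvR : v ∉ T.res := fun h => hv (T.res_sub h)
    unfold stellarSub relFaces
    rw [mem_filter, mem_sdiff, himg _ (fun σ h => mem_powerset.1 h),
      himg _ (fun σ h => (mem_removed.1 h).1), hθρ]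
    simp only [mem_powerset, mem_removed, hvτ, not_true_eq_false, false_imp_iff, true_imp_iff,
      true_and, insert_union, subset_insert_iff_of_notMem hvR, union_subset_iff]
    have h1 : insert v ρ ⊆ insert v T.simplex ↔ ρ ⊆ T.simplex := by
      rw [insert_subset_insert_iff hρ]
    have h2 : ∀ μ ∈ T.morse, (insert v ρ ⊆ insert v μ ↔ ρ ⊆ μ) := fun μ _ =>
      insert_subset_insert_iff hρ
    rw [h1]
    have h3 : (∀ μ ∈ T.morse, θ ⊆ μ → ¬ insert v ρ ⊆ insert v μ) ↔
        ∀ μ ∈ T.morse, ¬ ρ ∪ θ ⊆ μ := by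
      refine forall₂_congr fun μ hμ => ?_
      rw [h2 μ hμ, union_subset_iff]
      tauto
    rw [h3]
    have h4 : ρ ∪ θ ∈ T.faceSet ↔ (ρ ⊆ T.simplex ∧ T.res ⊆ ρ ∪ θ ∧ ∀ μ ∈ T.morse, ¬ ρ ∪ θ ⊆ μ) := by
      rw [mem_faceSet, union_subset_iff]
      have : ρ ∪ θ ≠ ∅ := (hne.mono subset_union_right).ne_empty
      tauto
    have h5 : ρ ⊆ T.simplex → ρ ∈ T.faceSet → ρ ∪ θ ∈ T.faceSet := fun h h' =>
      faceSet_upward h' subset_union_left (union_subset h hθ)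
    have h6 : insert v ρ ≠ ∅ := (insert_nonempty _ _).ne_empty
    by_cases hρσ : ρ ⊆ T.simplex
    · simp only [hρσ, hθ, h6, true_and, and_true, ne_eq, not_false_eq_true] at h4 h5 ⊢
      rw [← h4]
      tauto
    · simp [hρσ]
  · have himg (L : Finset (Finset V)) : τ ∈ stellar L θ v ↔ τ ∈ L ∧ ¬ θ ⊆ τ := by
      simp only [stellar, mem_union, mem_filter, mem_image]
      refine ⟨?_, Or.inl⟩
      rintro (h | ⟨ρ, -, rfl⟩)
      · exact h
      · exact absurd (mem_insert_self _ _) hvτ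
    unfold stellarSub relFaces
    rw [mem_filter, mem_sdiff, himg, himg, mem_removed, mem_powerset, mem_faceSet,
      subset_insert_iff_of_notMem hvτ]
    tauto

lemma Isom.of_perm {T T' : MorseTile V} (e : Equiv.Perm V) (hs : T.simplex.image e = T'.simplex)
    (hr : T.res.image e = T'.res) (hm : T.morse.map (fun μ => μ.image e) = T'.morse) :
    Isom T T' := by
  refine ⟨e, e.injective.injOn, hs, ?_⟩
  have hsub (a b : Finset V) : a.image e ⊆ b.image e ↔ a ⊆ b :=
    image_subset_image_iff e.injective
  have hmem (τ : Finset V) : τ.image e ∈ T'.faceSet ↔ τ ∈ T.faceSet := by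
    rw [mem_faceSet, mem_faceSet, ← hs, ← hr, ← hm, hsub, hsub]
    simp [hsub]
  ext τ
  obtain ⟨ρ, rfl⟩ : ∃ ρ : Finset V, τ = ρ.image e :=
    ⟨τ.image e.symm, by simp [image_image]⟩
  rw [hmem, mem_image]
  constructor
  · rintro ⟨ρ', h, h'⟩
    rwa [← Finset.image_injective e.injective h']
  · exact fun h => ⟨ρ, h, rfl⟩

end MorseTile

lemma image_swap_of_notMem {s : Finset V} {x y : V} (hx : x ∉ s) (hy : y ∉ s) :
    s.image (Equiv.swap x y) = s := by
  rw [← image_id (s := s), image_image]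
  refine image_congr fun z hz => Equiv.swap_apply_of_ne_of_ne ?_ ?_
  · rintro rfl; exact hx hz
  · rintro rfl; exact hy hz

lemma image_swap_insert_erase {s : Finset V} {x y : V} (hx : x ∈ s) (hy : y ∉ s) :
    (insert y (s.erase x)).image (Equiv.swap x y) = s := by
  rw [image_insert, Equiv.swap_apply_right,
    image_swap_of_notMem (by simp) (fun h => hy (mem_of_mem_erase h)), insert_erase hx]

lemma card_insert_erase {s : Finset V} {x y : V} (hx : x ∈ s) (hy : y ∉ s) :
    (insert y (s.erase x)).card = s.card := by
  rw [card_insert_of_notMem (fun h => hy (mem_of_mem_erase h)), card_erase_add_one hx]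

lemma insert_erase_ssubset {s t : Finset V} {x y : V} (hx : x ∈ s) (hy : y ∉ t) (hst : s ⊂ t) :
    insert y (s.erase x) ⊂ insert y (t.erase x) := by
  refine Finset.ssubset_iff_subset_ne.2 ⟨insert_subset_insert _ (erase_subset_erase _ hst.1),
    fun h => ?_⟩
  have := congrArg card h
  rw [card_insert_erase hx fun h => hy (hst.1 h), card_insert_erase (hst.1 hx) hy] at this
  exact (card_lt_card hst).ne this

namespace MorseTile

/-- A cell of the stellar subdivision opposite to a vertex of the restriction set is a tile. -/
lemma exists_tile_of_mem_res (T : MorseTile V) {θ P : Finset V} {v x : V} (hθ : θ ⊆ T.simplex)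
    (hv : v ∉ T.simplex) (hxθ : x ∈ θ) (hP : P ⊆ θ) (hxP : x ∉ P) (hxR : x ∈ T.res) :
    ∃ t : MorseTile V, t.faceSet = cell (T.stellarSub θ v) P x ∧
      t.simplex = insert v (T.simplex.erase x) ∧ t.res = insert v (T.res \ θ ∪ P) ∧
      t.morse = (T.morse.filter (θ ⊆ ·)).map (fun μ => insert v (μ.erase x)) := by
  have hsx := hθ hxθ
  have hvx : v ≠ x := fun h => hv (h ▸ hsx)
  have hmorse : ∀ μ' ∈ (T.morse.filter (θ ⊆ ·)).map (fun μ => insert v (μ.erase x)),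
      ∃ μ ∈ T.morse, θ ⊆ μ ∧ μ' = insert v (μ.erase x) := by
    intro μ' h
    simp only [Option.mem_def, Option.map_eq_some_iff, Option.filter_eq_some_iff] at h
    obtain ⟨μ, ⟨h1, h2⟩, rfl⟩ := h
    exact ⟨μ, h1, by simpa using h2, rfl⟩
  refine ⟨⟨insert v (T.simplex.erase x), insert v (T.res \ θ ∪ P), _, insert_nonempty _ _, ?_, ?_,
    ?_, ?_⟩, ?_, rfl, rfl, rfl⟩
  · have := T.res_sub
    grind
  · intro μ' hμ'
    obtain ⟨μ, hμ, hθμ, rfl⟩ := hmorse μ' hμ'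
    have := T.morse_res μ hμ
    grind
  · intro μ' hμ'
    obtain ⟨μ, hμ, hθμ, rfl⟩ := hmorse μ' hμ'
    exact insert_erase_ssubset (hθμ hxθ) hv (T.morse_ssub μ hμ)
  · intro μ' hμ'
    obtain ⟨μ, hμ, hθμ, rfl⟩ := hmorse μ' hμ'
    rw [card_insert_erase hsx hv,
      card_insert_erase (hθμ hxθ) (fun h => hv ((T.morse_ssub μ hμ).1 h))]
    exact T.morse_card μ hμ
  · ext τ
    rw [mem_cell, mem_stellarSub hθ ⟨x, hxθ⟩ hv, mem_faceSet]
    change τ ⊆ insert v (T.simplex.erase x) ∧ insert v (T.res \ θ ∪ P) ⊆ τ ∧ τ ≠ ∅ ∧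
      (∀ μ' ∈ (T.morse.filter (θ ⊆ ·)).map (fun μ => insert v (μ.erase x)), ¬ τ ⊆ μ') ↔ _
    by_cases hxτ : x ∈ τ
    · grind
    by_cases hvτ : v ∈ τ
    · have h1 : (∀ μ' ∈ (T.morse.filter (θ ⊆ ·)).map (fun μ => insert v (μ.erase x)), ¬ τ ⊆ μ') ↔
          ∀ μ ∈ T.morse, θ ⊆ μ → ¬ τ ⊆ insert v μ := by
        simp only [Option.mem_def, Option.map_eq_some_iff, Option.filter_eq_some_iff,
          decide_eq_true_eq]
        constructor
        · intro h μ hm hθμ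
          have := h _ ⟨μ, ⟨hm, hθμ⟩, rfl⟩
          grind
        · rintro h _ ⟨μ, ⟨hm, hθμ⟩, rfl⟩
          have := h μ hm hθμ
          grind
      rw [h1]
      grind
    · grind

/-- A cell of the stellar subdivision opposite to a vertex outside of the restriction set is a
tile. -/
lemma exists_tile_of_notMem_res (T : MorseTile V) {θ P : Finset V} {v x : V} (hθ : θ ⊆ T.simplex)
    (hv : v ∉ T.simplex) (hxθ : x ∈ θ) (hP : P ⊆ θ) (hxP : x ∉ P) (hxR : x ∉ T.res)
    (hR : T.res ∩ θ ⊆ P) (hμ : ∀ μ ∈ T.morse, P ⊆ μ → ¬ θ ⊆ μ → x ∉ μ) :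
    ∃ t : MorseTile V, t.faceSet = cell (T.stellarSub θ v) P x ∧
      t.simplex = insert v (T.simplex.erase x) ∧ t.res = T.res ∪ P ∧
      t.morse = (T.morse.filter (P ⊆ ·)).map
        (fun μ => if θ ⊆ μ then insert v (μ.erase x) else μ) := by
  have hsx := hθ hxθ
  have hvx : v ≠ x := fun h => hv (h ▸ hsx)
  have hmorse : ∀ μ' ∈ (T.morse.filter (P ⊆ ·)).map
      (fun μ => if θ ⊆ μ then insert v (μ.erase x) else μ),
      ∃ μ ∈ T.morse, P ⊆ μ ∧ (θ ⊆ μ ∧ μ' = insert v (μ.erase x) ∨ ¬ θ ⊆ μ ∧ μ' = μ) := by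
    intro μ' h
    simp only [Option.mem_def, Option.map_eq_some_iff, Option.filter_eq_some_iff] at h
    obtain ⟨μ, ⟨h1, h2⟩, rfl⟩ := h
    refine ⟨μ, h1, by simpa using h2, ?_⟩
    split_ifs with h <;> simp [h]
  refine ⟨⟨insert v (T.simplex.erase x), T.res ∪ P, _, insert_nonempty _ _, ?_, ?_,
    ?_, ?_⟩, ?_, rfl, rfl, rfl⟩
  · have := T.res_sub
    grind
  · intro μ' hμ'
    obtain ⟨μ, hm, hPμ, ⟨hθμ, rfl⟩ | ⟨hθμ, rfl⟩⟩ := hmorse μ' hμ' <;>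
    · have := T.morse_res _ hm
      grind
  · intro μ' hμ'
    obtain ⟨μ, hm, hPμ, ⟨hθμ, rfl⟩ | ⟨hθμ, rfl⟩⟩ := hmorse μ' hμ'
    · exact insert_erase_ssubset (hθμ hxθ) hv (T.morse_ssub μ hm)
    · have hsub := (T.morse_ssub _ hm).1
      have hx := hμ _ hm hPμ hθμ
      rw [Finset.ssubset_iff_of_subset (by grind)]
      exact ⟨v, by simp, fun h => hv (hsub h)⟩
  · intro μ' hμ'
    rw [card_insert_erase hsx hv]
    obtain ⟨μ, hm, hPμ, ⟨hθμ, rfl⟩ | ⟨hθμ, rfl⟩⟩ := hmorse μ' hμ'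
    · rw [card_insert_erase (hθμ hxθ) (fun h => hv ((T.morse_ssub μ hm).1 h))]
      exact T.morse_card μ hm
    · exact T.morse_card _ hm
  · ext τ
    rw [mem_cell, mem_stellarSub hθ ⟨x, hxθ⟩ hv, mem_faceSet]
    change τ ⊆ insert v (T.simplex.erase x) ∧ T.res ∪ P ⊆ τ ∧ τ ≠ ∅ ∧
      (∀ μ' ∈ (T.morse.filter (P ⊆ ·)).map
        (fun μ => if θ ⊆ μ then insert v (μ.erase x) else μ), ¬ τ ⊆ μ') ↔ _
    by_cases hxτ : x ∈ τ
    · grind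
    by_cases hPτ : P ⊆ τ
    swap
    · grind
    have hvR : v ∉ T.res := fun h => hv (T.res_sub h)
    have h1 : (∀ μ' ∈ (T.morse.filter (P ⊆ ·)).map
        (fun μ => if θ ⊆ μ then insert v (μ.erase x) else μ), ¬ τ ⊆ μ') ↔
        ∀ μ ∈ T.morse, if v ∈ τ then θ ⊆ μ → ¬ τ ⊆ insert v μ else ¬ τ ⊆ μ := by
      simp only [Option.mem_def, Option.map_eq_some_iff, Option.filter_eq_some_iff,
        decide_eq_true_eq]
      constructor
      · intro h μ hm
        have hvμ : v ∉ μ := fun h => hv ((T.morse_ssub μ hm).1 h)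
        have := h (if θ ⊆ μ then insert v (μ.erase x) else μ)
        grind
      · rintro h _ ⟨μ, ⟨hm, hPμ⟩, rfl⟩
        have hvμ : v ∉ μ := fun h => hv ((T.morse_ssub μ hm).1 h)
        have := h μ hm
        grind
    rw [h1]
    by_cases hvτ : v ∈ τ
    · simp only [hvτ, if_true]
      grind
    · simp only [hvτ, if_false]
      grind

/-- The shelling of the stellar subdivision of a Morse tile. -/
lemma exists_shelling_stellarSub (T : MorseTile V) {θ : Finset V} {v : V} (hθ : θ ⊆ T.simplex)
    (hne : θ.Nonempty) (hv : v ∉ T.simplex) :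
    ∃ (ts : List (MorseTile V)) (T₀ : MorseTile V),
      IsMorseShelling (T.stellarSub θ v) ts ∧ T₀ ∈ ts ∧ Isom T₀ T ∧
      ∀ T' ∈ ts, T' ≠ T₀ →
        ((∀ μ ∈ T.morse, ¬ θ ⊆ μ) → T'.IsBasic) ∧ ¬ T'.IsCritical ∧ T'.dim = T.dim := by
  have hdim {t : MorseTile V} {x : V} (hx : x ∈ θ)
      (ht : t.simplex = insert v (T.simplex.erase x)) : t.dim = T.dim := by
    rw [dim, dim, ht, card_insert_erase (hθ hx) hv]
  have hcov : ∀ τ ∈ T.stellarSub θ v, ¬ θ ⊆ τ := fun τ hτ =>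
    ((mem_stellarSub hθ hne hv).1 hτ).2.1
  have hvR : v ∉ T.res := fun h => hv (T.res_sub h)
  have hvμ : ∀ μ ∈ T.morse, v ∉ μ := fun μ hμ h => hv ((T.morse_ssub μ hμ).1 h)
  have hres : ∀ x ∈ T.res ∩ θ, ∀ P ⊆ θ, x ∉ P → (∃ y ∈ θ, y ≠ x ∧ y ∉ P) →
      ∃ t : MorseTile V, t.faceSet = cell (T.stellarSub θ v) P x ∧ t.dim = T.dim ∧
        (((∀ μ ∈ T.morse, ¬ θ ⊆ μ) → t.IsBasic) ∧ ¬ t.IsCritical) := by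
    rintro x hx P hP hxP ⟨y, hyθ, hyx, hyP⟩
    rw [mem_inter] at hx
    obtain ⟨t, htf, hts, htr, htm⟩ := T.exists_tile_of_mem_res hθ hv hx.2 hP hxP hx.1
    have hyv : y ≠ v := fun h => hv (h ▸ hθ hyθ)
    have hyt : y ∉ t.res := by rw [htr]; grind
    refine ⟨t, htf, hdim hx.2 hts, fun h => ?_, ?_⟩
    · rw [IsBasic, htm, Option.map_eq_none_iff, Option.filter_eq_none_iff]
      simpa using h
    · rintro (h | h)
      · rw [htm] at h
        simp only [Option.map_eq_some_iff, Option.filter_eq_some_iff, decide_eq_true_eq] at h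
        obtain ⟨μ, ⟨-, hθμ⟩, h⟩ := h
        exact hyt (h ▸ by simp [hyx, hθμ hyθ])
      · exact hyt (h ▸ hts ▸ by simp [hyx, hθ hyθ])
  by_cases hθR : θ ⊆ T.res
  · obtain ⟨x₀, hx₀⟩ := hne
    obtain ⟨T₀, h0f, h0s, h0r, h0m⟩ := T.exists_tile_of_mem_res (P := θ.erase x₀) hθ hv hx₀
      (erase_subset _ _) (by simp) (hθR hx₀)
    obtain ⟨ts, hts, hT₀, hQ⟩ := exists_shelling_of_pivot (A := θ.erase x₀) (B := ∅) (by simp)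
      (by simp) (by simp) (by simpa [insert_erase hx₀] using hcov) h0f (hdim hx₀ h0s)
      (fun x hx P hP hxP => hres x (by grind) P (by grind) hxP ⟨x₀, hx₀, by grind, by grind⟩)
      (by simp)
    refine ⟨ts, T₀, hts, hT₀, Isom.of_perm (Equiv.swap x₀ v) ?_ ?_ ?_, fun T' hT' hne' =>
      ⟨((hQ T' hT').2 hne').1, ((hQ T' hT').2 hne').2, (hQ T' hT').1⟩⟩
    · rw [h0s, image_swap_insert_erase (hθ hx₀) hv]
    · have : T.res \ θ ∪ θ.erase x₀ = T.res.erase x₀ := by grind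
      rw [h0r, this, image_swap_insert_erase (hθR hx₀) hvR]
    · rw [h0m]
      cases hm : T.morse with
      | none => simp
      | some μ =>
        have hθμ : θ ⊆ μ := hθR.trans (T.morse_res μ hm)
        simp [Option.filter, hθμ, image_swap_insert_erase (hθμ hx₀) (hvμ μ hm)]
  · obtain ⟨x₀, hx₀, hx₀R, hx₀μ⟩ :
        ∃ x₀ ∈ θ, x₀ ∉ T.res ∧ ∀ μ ∈ T.morse, ¬ θ ⊆ μ → x₀ ∉ μ := by
      by_cases h : ∃ μ ∈ T.morse, ¬ θ ⊆ μ
      · obtain ⟨μ, hμ, hθμ⟩ := h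
        obtain ⟨x, hx, hxμ⟩ := not_subset.1 hθμ
        refine ⟨x, hx, fun h => hxμ (T.morse_res μ hμ h), fun μ' hμ' _ => ?_⟩
        rwa [Option.mem_unique hμ' hμ]
      · push Not at h
        obtain ⟨x, hx, hxR⟩ := not_subset.1 hθR
        exact ⟨x, hx, hxR, fun μ hμ h' => absurd (h μ hμ) h'⟩
    obtain ⟨T₀, h0f, h0s, h0r, h0m⟩ := T.exists_tile_of_notMem_res (P := T.res ∩ θ) hθ hv hx₀
      inter_subset_right (by simp [hx₀R]) hx₀R subset_rfl (fun μ hμ _ => hx₀μ μ hμ)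
    obtain ⟨ts, hts, hT₀, hQ⟩ := exists_shelling_of_pivot (A := T.res ∩ θ)
      (B := (θ \ T.res).erase x₀) (by simp [hx₀R]) (by simp)
      (by rw [Finset.disjoint_left]; grind)
      (fun τ hτ h => hcov τ hτ (fun y hy => h (by grind))) h0f (hdim hx₀ h0s)
      (fun x hx P hP hxP => hres x hx P (by grind) hxP ⟨x₀, hx₀, by grind, by grind⟩)
      (Q := fun t => ((∀ μ ∈ T.morse, ¬ θ ⊆ μ) → t.IsBasic) ∧ ¬ t.IsCritical)
      (fun x hx P hP hAP hxP => by
        have hx₀P : x₀ ∈ P := hAP (mem_insert_self _ _)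
        have hxθ : x ∈ θ := by grind
        have hP' : ∀ μ ∈ T.morse, P ⊆ μ → θ ⊆ μ := fun μ hμ h => by
          by_contra h'
          exact hx₀μ μ hμ h' (h hx₀P)
        obtain ⟨t, htf, hts, htr, htm⟩ := T.exists_tile_of_notMem_res (P := P) hθ hv hxθ
          (by grind) hxP (by grind) (by grind) (fun μ hμ h h' => absurd (hP' μ hμ h) h')
        have hvt : v ∉ t.res := by
          rw [htr]
          have : v ∉ θ := fun h => hv (hθ h)
          grind
        refine ⟨t, htf, hdim hxθ hts, fun h => ?_, ?_⟩
        · rw [IsBasic, htm, Option.map_eq_none_iff, Option.filter_eq_none_iff]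
          intro μ hμ h'
          exact h μ hμ (hP' μ hμ (by simpa using h'))
        · rintro (h | h)
          · rw [htm] at h
            simp only [Option.map_eq_some_iff, Option.filter_eq_some_iff, decide_eq_true_eq] at h
            obtain ⟨μ, ⟨hμ, hPμ⟩, h⟩ := h
            rw [if_pos (hP' μ hμ hPμ)] at h
            exact hvt (h ▸ mem_insert_self _ _)
          · exact hvt (h ▸ hts ▸ mem_insert_self _ _))
    refine ⟨ts, T₀, hts, hT₀, Isom.of_perm (Equiv.swap x₀ v) ?_ ?_ ?_, fun T' hT' hne' =>
      ⟨((hQ T' hT').2 hne').1, ((hQ T' hT').2 hne').2, (hQ T' hT').1⟩⟩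
    · rw [h0s, image_swap_insert_erase (hθ hx₀) hv]
    · rw [h0r, union_eq_left.2 inter_subset_left, image_swap_of_notMem hx₀R hvR]
    · rw [h0m]
      cases hm : T.morse with
      | none => simp
      | some μ =>
        have hRμ : T.res ∩ θ ⊆ μ := inter_subset_left.trans (T.morse_res μ hm)
        by_cases hθμ : θ ⊆ μ
        · simp [Option.filter, hRμ, hθμ, image_swap_insert_erase (hθμ hx₀) (hvμ μ hm)]
        · simp [Option.filter, hRμ, hθμ, image_swap_of_notMem (hx₀μ μ hm hθμ) (hvμ μ hm)]

end MorseTile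

/-- stellar subdivisions of a Morse tile at a face of positive dimension
carry Morse shellings using a unique tile isomorphic to the original one. -/
theorem stellar_subdivision_of_morse_tile {V : Type*} [DecidableEq V] (n : ℕ)
    (T : MorseTile V) (hdim : T.dim = n)
    (θ : Finset V) (hθ : θ ⊆ T.simplex) (hθdim : 2 ≤ θ.card)
    (v : V) (hv : v ∉ T.simplex) :
    ((∀ μ ∈ T.morse, ¬ θ ⊆ μ) →
      ∃ (ts : List (MorseTile V)) (T₀ : MorseTile V),
        IsMorseShelling (T.stellarSub θ v) ts ∧ T₀ ∈ ts ∧ MorseTile.Isom T₀ T ∧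
        ∀ T' ∈ ts, T' ≠ T₀ → T'.IsBasic ∧ ¬ T'.IsCritical ∧ T'.dim = n) ∧
    ((∃ μ ∈ T.morse, θ ⊆ μ) →
      ∃ (ts : List (MorseTile V)) (T₀ : MorseTile V),
        IsMorseShelling (T.stellarSub θ v) ts ∧ T₀ ∈ ts ∧ MorseTile.Isom T₀ T ∧
        ∀ T' ∈ ts, T' ≠ T₀ → ¬ T'.IsCritical ∧ T'.dim = n) := by
  subst hdim
  obtain ⟨ts, T₀, hts, hT₀, hiso, h⟩ :=
    T.exists_shelling_stellarSub hθ (card_pos.1 (by omega)) hv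
  exact ⟨fun hμ => ⟨ts, T₀, hts, hT₀, hiso, fun T' hT' hne =>
      ⟨(h T' hT' hne).1 hμ, (h T' hT' hne).2⟩⟩,
    fun _ => ⟨ts, T₀, hts, hT₀, hiso, fun T' hT' hne => (h T' hT' hne).2⟩⟩
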